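/- Assume ℙ{V(ω,z) ≥ 0} = 1 for all z ∈ R₀ and that there exists c ∈ ℝ with ℙ{V(ω,z) ≥ c} = 1 for all z ∈ R∖R₀. Then there exists a finite positive constant C such that, ℙ-almost surely, a(ω,x,y) ≥ −C|y−x|₁ for all x, y ∈ ℤ^d with y − x ∈ G₊. -/

import Mathlib

open MeasureTheory Filter Set
open scoped ENNReal NNReal Classical Topology

noncomputable section

namespace RWRP

abbrev Zd (d : ℕ) := Fin d → ℤ

variable {d : ℕ} {Ω : Type*} {Γ : Type*}

/-- Embedding of `ℤ^d` into `ℝ^d`. -/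
def toR (x : Zd d) : Fin d → ℝ := fun i => (x i : ℝ)

/-- The `ℓ¹` norm on `ℝ^d`. -/
def n1 (ξ : Fin d → ℝ) : ℝ := ∑ i, |ξ i|

/-- The `ℓ¹` norm of a lattice point. -/
def n1Z (x : Zd d) : ℝ := n1 (toR x)

/-- `G₊`: the additive semigroup (ℤ₊-combinations) generated by the step set. -/
def Gp (R : Finset (Zd d)) : Set (Zd d) := {x | ∃ b : Zd d → ℕ, x = ∑ z ∈ R, b z • z}

/-- `G(R')`: the additive group (ℤ-combinations) generated by `R'`. -/
def GZ (R : Finset (Zd d)) : Set (Zd d) := {x | ∃ b : Zd d → ℤ, x = ∑ z ∈ R, b z • z}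

/-- ℤ₊-combinations of elements of a set of lattice points. -/
def GpS (S : Set (Zd d)) : Set (Zd d) :=
  {x | ∃ (m : ℕ) (c : Fin m → Zd d), (∀ i, c i ∈ S) ∧ x = ∑ i, c i}

/-- `C₊`: the real cone generated by the step set. -/
def Cp (R : Finset (Zd d)) : Set (Fin d → ℝ) :=
  {ξ | ∃ b : Zd d → ℝ, (∀ z, 0 ≤ b z) ∧ ξ = ∑ z ∈ R, b z • toR z}

/-- `C'₊`: the rational cone generated by the step set. -/
def CpQ (R : Finset (Zd d)) : Set (Fin d → ℝ) :=
  {ξ | ∃ b : Zd d → ℚ, (∀ z, 0 ≤ b z) ∧ ξ = ∑ z ∈ R, (b z : ℝ) • toR z}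

/-- `A` is a face of the convex set `K`. -/
def IsFace (K A : Set (Fin d → ℝ)) : Prop :=
  A ⊆ K ∧ Convex ℝ A ∧
    ∀ ⦃ξ ζ η : Fin d → ℝ⦄ ⦃t : ℝ⦄, ξ ∈ A → ζ ∈ K → η ∈ K → t ∈ Set.Ioo (0:ℝ) 1 →
      ξ = t • ζ + (1 - t) • η → ζ ∈ A ∧ η ∈ A

/-- `U`: the convex hull of the step set. -/
def hullU (R : Finset (Zd d)) : Set (Fin d → ℝ) := convexHull ℝ (toR '' (R : Set (Zd d)))

/-- `U₀` is the face of `U` containing `0` in its relative interior (the empty set if `0 ∉ U`). -/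
def IsZeroFace (R : Finset (Zd d)) (U₀ : Set (Fin d → ℝ)) : Prop :=
  ((0 : Fin d → ℝ) ∈ hullU R ∧ IsFace (hullU R) U₀ ∧
    (0 : Fin d → ℝ) ∈ intrinsicInterior ℝ U₀) ∨
  ((0 : Fin d → ℝ) ∉ hullU R ∧ U₀ = ∅)

/-- `R₀ = R ∩ U₀`. -/
def R0 (R : Finset (Zd d)) (U₀ : Set (Fin d → ℝ)) : Set (Zd d) := {z | z ∈ R ∧ toR z ∈ U₀}

/-- `A_δ`: the directions in the face `A` at ℓ¹ distance `≥ δ` (after normalization) from the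
relative boundary of `A`. -/
def faceDelta (A : Set (Fin d → ℝ)) (δ : ℝ) : Set (Fin d → ℝ) :=
  {ξ | ξ ∈ A ∧ ξ ≠ 0 ∧
    ENNReal.ofReal δ ≤ ⨅ (η : Fin d → ℝ) (_ : η ∈ A \ intrinsicInterior ℝ A),
      ENNReal.ofReal (n1 ((n1 ξ)⁻¹ • ξ - η))}

/-- `U'_δ = {ξ ∈ U' : dist(ξ, U' ∖ relint Uall) ≥ δ}`. -/
def faceDeltaU (Uall U' : Set (Fin d → ℝ)) (δ : ℝ) : Set (Fin d → ℝ) :=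
  {ξ | ξ ∈ U' ∧
    ENNReal.ofReal δ ≤ ⨅ (η : Fin d → ℝ) (_ : η ∈ U' \ intrinsicInterior ℝ Uall),
      ENNReal.ofReal (n1 (ξ - η))}

/-- `D_n`: points reachable in exactly `n` admissible steps (counted with multiplicities). -/
def Dn (R : Finset (Zd d)) (n : ℕ) : Set (Zd d) :=
  {x | ∃ b : Zd d → ℕ, (∑ z ∈ R, b z) = n ∧ x = ∑ z ∈ R, b z • z}

/-- Position after `k` steps of the path with increments `f`, started at `x`. -/
def pos (x : Zd d) (f : ℕ → Zd d) (k : ℕ) : Zd d := x + ∑ i ∈ Finset.range k, f i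

/-- Convert a finite tuple of admissible steps to an increment sequence. -/
def stepF {R : Finset (Zd d)} (n : ℕ) (s : Fin n → {z : Zd d // z ∈ R}) : ℕ → Zd d :=
  fun i => if h : i < n then (s ⟨i, h⟩ : Zd d) else 0

/-- The path started at `x` with increments `f` hits `y` for the first time (after time `0`)
at time `n`. -/
def firstHit (x y : Zd d) (n : ℕ) (f : ℕ → Zd d) : Prop :=
  pos x f n = y ∧ ∀ k ∈ Finset.Ioo 0 n, pos x f k ≠ y

/-- Probability weight of a tuple of steps under the random walk kernel `p`. -/
def pathW (p : Zd d → ℝ) {R : Finset (Zd d)} {n : ℕ} (s : Fin n → {z : Zd d // z ∈ R}) : ℝ≥0∞ :=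
  ∏ i, ENNReal.ofReal (p (s i : Zd d))

/-- Total potential collected along the first `n` steps of a path. -/
def pathV (T : Zd d → Ω → Ω) (V : Ω → Zd d → ℝ) (ω : Ω) (x : Zd d) (n : ℕ)
    (f : ℕ → Zd d) : ℝ :=
  ∑ i ∈ Finset.range n, V (T (pos x f i) ω) (f i)

/-- `E_x[exp(-∑_{k<τ_y} V(T_{X_k}ω, Z_{k+1})) 1{τ_y < ∞}]`, as a sum over killed paths. -/
def walkK (T : Zd d → Ω → Ω) (V : Ω → Zd d → ℝ) (p : Zd d → ℝ) (R : Finset (Zd d))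
    (ω : Ω) (x y : Zd d) : ℝ≥0∞ :=
  ∑' n : ℕ, ∑ s : Fin (n+1) → {z : Zd d // z ∈ R},
    if firstHit x y (n+1) (stepF (n+1) s) then
      pathW p s * ENNReal.ofReal (Real.exp (-(pathV T V ω x (n+1) (stepF (n+1) s))))
    else 0

/-- The point-to-point quantity `a(ω,x,y)` (real-valued version, with junk values where the
underlying expectation is `0` or `∞`). -/
def aFun (T : Zd d → Ω → Ω) (V : Ω → Zd d → ℝ) (p : Zd d → ℝ) (R : Finset (Zd d))
    (ω : Ω) (x y : Zd d) : ℝ :=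
  if y = x then 0 else - Real.log ((walkK T V p R ω x y).toReal)

/-- The point-to-point quantity `a(ω,x,y)` with values in `[-∞,∞]`. -/
def aE (T : Zd d → Ω → Ω) (V : Ω → Zd d → ℝ) (p : Zd d → ℝ) (R : Finset (Zd d))
    (ω : Ω) (x y : Zd d) : EReal :=
  if y = x then (0 : EReal) else - (ENNReal.log (walkK T V p R ω x y))

/-- The zero-temperature quantity `a_∞(ω,x,y)`: the infimum of the total potential over
admissible paths from `x` to `y` that hit `y` for the first time at their last step. -/
def aInf (T : Zd d → Ω → Ω) (V : Ω → Zd d → ℝ) (R : Finset (Zd d))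
    (ω : Ω) (x y : Zd d) : ℝ :=
  if y = x then 0 else
    sInf {v : ℝ | ∃ n : ℕ, ∃ s : Fin (n+1) → {z : Zd d // z ∈ R},
      firstHit x y (n+1) (stepF (n+1) s) ∧ v = pathV T V ω x (n+1) (stepF (n+1) s)}

/-- The Green's function `g(ω,x,y)`, with values in `[0,∞]`. -/
def greenK (T : Zd d → Ω → Ω) (V : Ω → Zd d → ℝ) (p : Zd d → ℝ) (R : Finset (Zd d))
    (ω : Ω) (x y : Zd d) : ℝ≥0∞ :=
  (if y = x then 1 else 0) +
  ∑' n : ℕ, ∑ s : Fin (n+1) → {z : Zd d // z ∈ R},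
    if pos x (stepF (n+1) s) (n+1) = y then
      pathW p s * ENNReal.ofReal (Real.exp (-(pathV T V ω x (n+1) (stepF (n+1) s))))
    else 0

/-- `E_x[exp(-∑_{k<n} V) 1{X_n = y}]`: the restricted-length partition function. -/
def resK (T : Zd d → Ω → Ω) (V : Ω → Zd d → ℝ) (p : Zd d → ℝ) (R : Finset (Zd d))
    (ω : Ω) (n : ℕ) (x y : Zd d) : ℝ≥0∞ :=
  ∑ s : Fin n → {z : Zd d // z ∈ R},
    if pos x (stepF n s) n = y then
      pathW p s * ENNReal.ofReal (Real.exp (-(pathV T V ω x n (stepF n s))))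
    else 0

/-- `G_{x,(n),y} = log E_x[exp(-∑_{k<n} V) 1{X_n = y}]`. -/
def GRes (T : Zd d → Ω → Ω) (V : Ω → Zd d → ℝ) (p : Zd d → ℝ) (R : Finset (Zd d))
    (ω : Ω) (n : ℕ) (x y : Zd d) : ℝ :=
  Real.log ((resK T V p R ω n x y).toReal)

/-- The return probability `P₀(τ₀ < ∞)` of the reference walk. -/
def retP (p : Zd d → ℝ) (R : Finset (Zd d)) : ℝ≥0∞ :=
  ∑' n : ℕ, ∑ s : Fin (n+1) → {z : Zd d // z ∈ R},
    if firstHit (0 : Zd d) 0 (n+1) (stepF (n+1) s) then pathW p s else 0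

/-- `R_ε`: the ℓ¹-distance from the origin to the nearest point `x` of `G₊(S)` with
`V(T_x ω, z) ≥ ε` for some `z ∈ S`, as an element of `[0,∞]`. -/
def Reps (T : Zd d → Ω → Ω) (V : Ω → Zd d → ℝ) (S : Set (Zd d)) (ε : ℝ) (ω : Ω) : ℝ≥0∞ :=
  ⨅ (x : Zd d) (_ : x ∈ GpS S ∧ ∃ z ∈ S, ε ≤ V (T x ω) z), ENNReal.ofReal (n1Z x)

/-- The shift maps on a product space. -/
def shiftT (z : Zd d) (ω : Zd d → Γ) : Zd d → Γ := fun y => ω (z + y)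

/-- A function is locally Lipschitz (w.r.t. the ℓ¹ norm) on a set. -/
def LocLipOn (f : (Fin d → ℝ) → ℝ) (S : Set (Fin d → ℝ)) : Prop :=
  ∀ ξ ∈ S, ∃ K ε : ℝ, 0 < ε ∧ ∀ x ∈ S, ∀ y ∈ S,
    n1 (x - ξ) < ε → n1 (y - ξ) < ε → |f x - f y| ≤ K * n1 (x - y)

section measurable

variable [MeasurableSpace Ω]

/-- The σ-algebra of measurable sets invariant under the shifts `{T_z : z ∈ S}`. -/
def invSigma (T : Zd d → Ω → Ω) (S : Set (Zd d)) : MeasurableSpace Ω where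
  MeasurableSet' A := MeasurableSet A ∧ ∀ z ∈ S, T z ⁻¹' A = A
  measurableSet_empty := ⟨MeasurableSet.empty, fun _ _ => by simp⟩
  measurableSet_compl A hA := ⟨hA.1.compl, fun z hz => by
    rw [Set.preimage_compl, hA.2 z hz]⟩
  measurableSet_iUnion f hf := ⟨MeasurableSet.iUnion fun i => (hf i).1, fun z hz => by
    rw [Set.preimage_iUnion]
    exact Set.iUnion_congr fun i => (hf i).2 z hz⟩

/-- `ℙ` is ergodic under the shifts `{T_z : z ∈ S}`. -/
def ErgodicUnder (ℙ : Measure Ω) (T : Zd d → Ω → Ω) (S : Set (Zd d)) : Prop :=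
  ∀ A : Set Ω, MeasurableSet A → (∀ z ∈ S, T z ⁻¹' A = A) → ℙ A = 0 ∨ ℙ A = 1

/-- The class `𝓛_{z,R'}`. -/
def classL (ℙ : Measure Ω) (T : Zd d → Ω → Ω) (g : Ω → ℝ) (z : Zd d)
    (R' : Finset (Zd d)) : Prop :=
  ∀ᵐ ω ∂ℙ,
    (⨅ ε : {e : ℝ // 0 < e},
      Filter.limsup (fun n : ℕ =>
        ⨆ (x : Zd d) (_ : x ∈ Gp R' ∧ n1Z x ≤ n),
          (n : ℝ≥0∞)⁻¹ *
            ∑ k ∈ Finset.range (⌊(ε : ℝ) * n⌋₊ + 1), ENNReal.ofReal (g (T (x + k • z) ω)))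
        Filter.atTop) = 0

/-- Extended conditional expectation, with values in `[-∞,∞]`: the decreasing limit of the
conditional expectations of the truncations `max f (-n)`.  It agrees a.s. with the usual
conditional expectation in `[-∞,∞)` whenever `f⁺` is integrable. -/
def condExpE (ℙ : Measure Ω) (m : MeasurableSpace Ω) (f : Ω → ℝ) : Ω → EReal :=
  fun ω => ⨅ n : ℕ, ((MeasureTheory.condExp m ℙ (fun ω' => max (f ω') (-(n : ℝ))) ω : ℝ) : EReal)

/-- `EReal → ℝ≥0∞`, sending `[-∞,0]` to `0` and `⊤` to `⊤`. -/
def erealToENN (x : EReal) : ℝ≥0∞ := if x = ⊤ then ⊤ else ENNReal.ofReal x.toReal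

/-- `ᾱ(x) = inf_{n ≥ 1} (1/n) E[a(0,nx) | I_x]`, with `ᾱ(0) = 0`. -/
def alphaBar (ℙ : Measure Ω) (T : Zd d → Ω → Ω) (V : Ω → Zd d → ℝ) (p : Zd d → ℝ)
    (R : Finset (Zd d)) (x : Zd d) : Ω → EReal :=
  fun ω =>
    if x = 0 then 0 else
    ⨅ n : {m : ℕ // 0 < m},
      (((n : ℕ) : ℝ)⁻¹ : EReal) *
        condExpE ℙ (invSigma T {x}) (fun ω' => aFun T V p R ω' 0 ((n : ℕ) • x)) ω

/-- `x̂_t(ξ) = ∑_z ⌊tγ_z⌋ z`. -/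
def xhat (R : Finset (Zd d)) (γ : Zd d → ℝ) (t : ℝ) : Zd d := ∑ z ∈ R, ⌊t * γ z⌋ • z

/-- `tilde-α(ξ) = inf_{t ∈ ℚ, t>0} (1/t) E[a(0, x̂_t(ξ)) | 𝔖]`, where `𝔖` is the σ-algebra of
sets invariant under the shifts from `S`. -/
def tAlpha (ℙ : Measure Ω) (T : Zd d → Ω → Ω) (V : Ω → Zd d → ℝ) (p : Zd d → ℝ)
    (R : Finset (Zd d)) (S : Set (Zd d)) (γ : Zd d → ℝ) : Ω → EReal :=
  fun ω => ⨅ t : {q : ℚ // 0 < q},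
    ((((t : ℚ) : ℝ))⁻¹ : EReal) *
      condExpE ℙ (invSigma T S) (fun ω' => aFun T V p R ω' 0 (xhat R γ ((t : ℚ) : ℝ))) ω

/-- The σ-algebra `𝔖_ξ` of sets invariant under the shifts from `R_ξ = R ∩ C_ξ`. -/
def Sface (T : Zd d → Ω → Ω) (R : Finset (Zd d))
    (Cface : (Fin d → ℝ) → Set (Fin d → ℝ)) (ξ : Fin d → ℝ) : MeasurableSpace Ω :=
  invSigma T {z | z ∈ R ∧ toR z ∈ Cface ξ}

/-- `tilde-α` as a function of the direction `ξ`, given a choice `Cface` of the face `C_ξ`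
and a choice `γfun` of cone coefficients. -/
def tAlphaF (ℙ : Measure Ω) (T : Zd d → Ω → Ω) (V : Ω → Zd d → ℝ) (p : Zd d → ℝ)
    (R : Finset (Zd d)) (Cface : (Fin d → ℝ) → Set (Fin d → ℝ))
    (γfun : (Fin d → ℝ) → Zd d → ℝ) (ξ : Fin d → ℝ) : Ω → EReal :=
  fun ω => if ξ = 0 then 0 else tAlpha ℙ T V p R {z | z ∈ R ∧ toR z ∈ Cface ξ} (γfun ξ) ω

/-- `B` is an `L¹` covariant cocycle on the group generated by the allowed steps. -/
def IsCocycle (ℙ : Measure Ω) (T : Zd d → Ω → Ω) (S : Set (Zd d))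
    (B : Ω → Zd d → Zd d → ℝ) : Prop :=
  (∀ x y : Zd d, Measurable fun ω => B ω x y) ∧
  (∀ x ∈ S, ∀ y ∈ S, Integrable (fun ω => B ω x y) ℙ) ∧
  (∀ᵐ ω ∂ℙ, ∀ x ∈ S, ∀ y ∈ S, ∀ z ∈ S, B ω x y + B ω y z = B ω x z) ∧
  (∀ᵐ ω ∂ℙ, ∀ x ∈ S, ∀ y ∈ S, ∀ z ∈ S, B ω (x + z) (y + z) = B (T z ω) x y)

/-- The class `K⁺_A(V)` of centered cocycles. -/
def InKplus (ℙ : Measure Ω) (T : Zd d → Ω → Ω) (V : Ω → Zd d → ℝ) (p : Zd d → ℝ)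
    (R' : Finset (Zd d)) (B : Ω → Zd d → Zd d → ℝ) : Prop :=
  IsCocycle ℙ T (GZ R') B ∧
  ∀ᵐ ω ∂ℙ, ∑ z ∈ R', p z * Real.exp (-(V ω z) - B ω 0 z) ≤ 1

/-- The standing setting: shifts, stationary `ℙ`, finite step set, measurable potential,
random walk kernel. -/
def Setting (ℙ : Measure Ω) (T : Zd d → Ω → Ω) (R : Finset (Zd d))
    (V : Ω → Zd d → ℝ) (p : Zd d → ℝ) : Prop :=
  (∀ z : Zd d, Measurable (T z)) ∧ T 0 = id ∧ (∀ x y : Zd d, T (x + y) = T x ∘ T y) ∧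
  (∀ z : Zd d, MeasurePreserving (T z) ℙ ℙ) ∧ 2 ≤ R.card ∧
  (∀ z : Zd d, Measurable fun ω => V ω z) ∧
  (∀ z ∈ R, 0 < p z ∧ p z < 1) ∧ ∑ z ∈ R, p z = 1

/-- `V⁺ ∈ L¹`. -/
def VplusL1 (ℙ : Measure Ω) (V : Ω → Zd d → ℝ) (R : Finset (Zd d)) : Prop :=
  ∀ z ∈ R, Integrable (fun ω => max (V ω z) 0) ℙ

/-- Assumption (i): `V ≥ 0` a.s. on `R₀` and `V ≥ c` a.s. on `R ∖ R₀`. -/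
def AssumptionI (ℙ : Measure Ω) (V : Ω → Zd d → ℝ) (R : Finset (Zd d))
    (U₀ : Set (Fin d → ℝ)) : Prop :=
  (∀ z ∈ R0 R U₀, ∀ᵐ ω ∂ℙ, 0 ≤ V ω z) ∧
  ∃ c : ℝ, ∀ z ∈ R, toR z ∉ U₀ → ∀ᵐ ω ∂ℙ, c ≤ V ω z

end measurable

end RWRP


namespace RWRP

lemma aux_sep {d : ℕ} (R : Finset (Zd d)) (U₀ : Set (Fin d → ℝ)) (h : IsZeroFace R U₀) :
    ∃ (f : StrongDual ℝ (Fin d → ℝ)) (δ : ℝ), 0 < δ ∧ (∀ z ∈ R, toR z ∈ U₀ → f (toR z) = 0) ∧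
      ∀ z ∈ R, toR z ∉ U₀ → δ ≤ f (toR z) := by
  have hface : IsFace (hullU R) U₀ := by
    rcases h with h | h
    · exact h.2.1
    · rw [h.2]
      exact ⟨Set.empty_subset _, convex_empty, fun _ _ _ _ h => absurd h (Set.notMem_empty _)⟩
  have hUL : ∀ ξ ∈ hullU R, ξ ∈ Submodule.span ℝ U₀ → ξ ∈ U₀ := by
    intro ξ hξ hL
    rcases h with ⟨h0, hf, hi⟩ | ⟨h0, he⟩
    · have h00 : (0 : Fin d → ℝ) ∈ U₀ := intrinsicInterior_subset hi
      have hLa : ∀ η ∈ Submodule.span ℝ U₀, η ∈ affineSpan ℝ U₀ := by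
        intro η hη
        have := affineSpan_insert_zero (k := ℝ) U₀
        rw [Set.insert_eq_of_mem h00] at this
        have h2 : η ∈ (affineSpan ℝ U₀ : Set (Fin d → ℝ)) := by rw [this]; exact hη
        exact h2
      rw [mem_intrinsicInterior] at hi
      obtain ⟨y, hy, hy0⟩ := hi
      let g : ℝ → affineSpan ℝ U₀ := fun t =>
        ⟨(-t) • ξ, hLa _ (Submodule.smul_mem _ _ hL)⟩
      have hg : Continuous g := by
        apply Continuous.subtype_mk
        fun_prop
      have hg0 : g 0 = y := by
        apply Subtype.ext
        simp [g, hy0]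
      have hn : ∀ᶠ t in 𝓝 (0:ℝ), g t ∈ interior ((↑) ⁻¹' U₀ : Set (affineSpan ℝ U₀)) := by
        apply hg.continuousAt.eventually_mem
        rw [hg0]
        exact isOpen_interior.mem_nhds hy
      have hn' : ∀ᶠ t in 𝓝[>] (0:ℝ), g t ∈ interior ((↑) ⁻¹' U₀ : Set (affineSpan ℝ U₀)) :=
        hn.filter_mono nhdsWithin_le_nhds
      obtain ⟨t, ht, htp⟩ := (hn'.and self_mem_nhdsWithin).exists
      have htp : 0 < t := htp
      have ht' : (-t) • ξ ∈ U₀ := by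
        have h3 : g t ∈ ((↑) ⁻¹' U₀ : Set (affineSpan ℝ U₀)) := interior_subset ht
        exact h3
      refine (hf.2.2 h00 hξ (hf.1 ht') (t := t / (1 + t)) ⟨by positivity, ?_⟩ ?_).1
      · rw [div_lt_one (by positivity)]; linarith
      · rw [smul_smul, ← add_smul]
        have : t / (1 + t) + (1 - t / (1 + t)) * -t = 0 := by field_simp; ring
        rw [this, zero_smul]
    · rw [he, Submodule.span_empty, Submodule.mem_bot] at hL
      exact absurd (hL ▸ hξ) h0
  let S : Set (Fin d → ℝ) := toR '' {z | z ∈ R ∧ toR z ∉ U₀}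
  have hSfin : S.Finite := (R.finite_toSet.subset (fun z hz => hz.1)).image _
  have hconv : Convex ℝ (hullU R \ U₀) := by
    rw [convex_iff_openSegment_subset]
    rintro a ⟨ha, ha'⟩ b ⟨hb, hb'⟩ w ⟨s, t, hs, ht, hst, rfl⟩
    refine ⟨convex_convexHull ℝ _ ha hb hs.le ht.le hst, fun hw => ha' ?_⟩
    refine (hface.2.2 hw ha hb (t := s) ⟨hs, by linarith⟩ ?_).1
    rw [← hst]; simp
  have hK : convexHull ℝ S ⊆ hullU R \ U₀ := by
    apply convexHull_min _ hconv
    rintro _ ⟨z, ⟨hz, hz'⟩, rfl⟩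
    exact ⟨subset_convexHull ℝ _ ⟨z, hz, rfl⟩, hz'⟩
  have hdisj : Disjoint (convexHull ℝ S) (Submodule.span ℝ U₀ : Set (Fin d → ℝ)) := by
    rw [Set.disjoint_left]
    intro a ha hb
    exact (hK ha).2 (hUL a (hK ha).1 hb)
  obtain ⟨f, u, v, hfu, huv, hfv⟩ := geometric_hahn_banach_compact_closed
    (convex_convexHull ℝ S) (hSfin.isCompact_convexHull (𝕜 := ℝ))
    (Submodule.span ℝ U₀).convex (Submodule.closed_of_finiteDimensional _) hdisj
  have hv0 : v < 0 := by simpa using hfv 0 (Submodule.zero_mem _)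
  refine ⟨-f, -u, by linarith, ?_, ?_⟩
  · intro z _ hz
    have hzL := Submodule.subset_span (R := ℝ) hz
    by_contra hne
    have hne' : f (toR z) ≠ 0 := by simpa using hne
    have := hfv ((v / f (toR z)) • toR z) (Submodule.smul_mem _ _ hzL)
    rw [map_smul, smul_eq_mul, div_mul_cancel₀ _ hne'] at this
    exact lt_irrefl _ this
  · intro z hz hz'
    have := hfu (toR z) (subset_convexHull ℝ _ ⟨z, ⟨hz, hz'⟩, rfl⟩)
    simp only [neg_apply]
    linarith

lemma pos_succ' {d : ℕ} (x : Zd d) (f : ℕ → Zd d) (k : ℕ) :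
    pos x f (k+1) = pos (x + f 0) (fun i => f (i+1)) k := by
  simp only [pos, Finset.sum_range_succ']
  abel

lemma stepF_cons {d : ℕ} {R : Finset (Zd d)} (n : ℕ) (z : {z : Zd d // z ∈ R})
    (s : Fin n → {z : Zd d // z ∈ R}) :
    stepF (n+1) (Fin.cons z s : Fin (n+1) → {z : Zd d // z ∈ R}) 0 = z ∧
    (fun i => stepF (n+1) (Fin.cons z s : Fin (n+1) → {z : Zd d // z ∈ R}) (i+1)) = stepF n s := by
  constructor
  · simp [stepF]
  · funext i
    by_cases h : i < n
    · have h' : i + 1 < n + 1 := by omega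
      simp only [stepF, dif_pos h, dif_pos h']
      rfl
    · simp [stepF, h]

lemma firstHit_succ {d : ℕ} (x y : Zd d) (n : ℕ) (f : ℕ → Zd d) :
    firstHit x y (n+2) f ↔ x + f 0 ≠ y ∧ firstHit (x + f 0) y (n+1) (fun i => f (i+1)) := by
  unfold firstHit
  rw [pos_succ']
  constructor
  · rintro ⟨h1, h2⟩
    refine ⟨?_, h1, ?_⟩
    · have := h2 1 (by simp)
      rw [pos_succ'] at this
      simpa [pos] using this
    · intro k hk
      rw [Finset.mem_Ioo] at hk
      rw [← pos_succ']
      exact h2 (k+1) (by rw [Finset.mem_Ioo]; omega)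
  · rintro ⟨h0, h1, h2⟩
    refine ⟨h1, ?_⟩
    intro k hk
    rw [Finset.mem_Ioo] at hk
    obtain ⟨k, rfl⟩ : ∃ j, k = j + 1 := ⟨k - 1, by omega⟩
    rw [pos_succ']
    rcases Nat.eq_zero_or_pos k with rfl | hk0
    · simpa [pos] using h0
    · exact h2 k (by rw [Finset.mem_Ioo]; omega)

def fh {d : ℕ} (p : Zd d → ℝ) (R : Finset (Zd d)) (y : Zd d) (n : ℕ) (x : Zd d) : ℝ≥0∞ :=
  ∑ s : Fin (n+1) → {z : Zd d // z ∈ R},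
    if firstHit x y (n+1) (stepF (n+1) s) then pathW p s else 0

lemma sum_cons {α : Type*} [Fintype α] (n : ℕ) (F : (Fin (n+1) → α) → ℝ≥0∞) :
    ∑ s, F s = ∑ z, ∑ s : Fin n → α, F (Fin.cons z s : Fin (n+1) → α) := by
  rw [← Fintype.sum_prod_type']
  exact (Fintype.sum_equiv (Fin.consEquiv (fun _ : Fin (n+1) => α)) _ _ (fun _ => rfl)).symm

lemma pathW_cons {d : ℕ} (p : Zd d → ℝ) {R : Finset (Zd d)} (n : ℕ) (z : {z : Zd d // z ∈ R})
    (s : Fin n → {z : Zd d // z ∈ R}) :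
    pathW p (Fin.cons z s : Fin (n+1) → {z : Zd d // z ∈ R})
      = ENNReal.ofReal (p z) * pathW p s := by
  simp [pathW, Fin.prod_univ_succ]

lemma fh_zero {d : ℕ} (p : Zd d → ℝ) (R : Finset (Zd d)) (y x : Zd d) :
    fh p R y 0 x = ∑ z : {z : Zd d // z ∈ R},
      ENNReal.ofReal (p z) * (if x + z = y then 1 else 0) := by
  unfold fh
  rw [sum_cons]
  refine Finset.sum_congr rfl fun z _ => ?_
  rw [Fintype.sum_unique]
  rw [pathW_cons]
  have : firstHit x y 1 (stepF 1 (Fin.cons z default : Fin (0+1) → {z : Zd d // z ∈ R}))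
      ↔ x + (z : Zd d) = y := by
    simp only [firstHit, pos, stepF]
    constructor
    · intro h; simpa using h.1
    · intro h
      refine ⟨by simpa using h, ?_⟩
      intro k hk
      rw [Finset.mem_Ioo] at hk
      omega
  simp only [zero_add, this]
  simp [pathW]

lemma fh_succ {d : ℕ} (p : Zd d → ℝ) (R : Finset (Zd d)) (y x : Zd d) (n : ℕ) :
    fh p R y (n+1) x = ∑ z : {z : Zd d // z ∈ R},
      ENNReal.ofReal (p z) * (if x + z = y then 0 else fh p R y n (x + z)) := by
  unfold fh
  rw [sum_cons]
  refine Finset.sum_congr rfl fun z _ => ?_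
  by_cases h : x + (z : Zd d) = y
  · simp [firstHit_succ, (stepF_cons _ z _).1, h]
  · simp only [firstHit_succ, (stepF_cons _ z _).1, (stepF_cons _ z _).2, pathW_cons, h, ne_eq,
      not_false_eq_true, true_and, if_false, Finset.mul_sum, mul_ite, mul_zero]

lemma fh_sum_le {d : ℕ} (p : Zd d → ℝ) (R : Finset (Zd d)) (y : Zd d)
    (hp : ∑ z : {z : Zd d // z ∈ R}, ENNReal.ofReal (p z) = 1) (N : ℕ) :
    ∀ x, ∑ n ∈ Finset.range N, fh p R y n x ≤ 1 := by
  induction N with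
  | zero => simp
  | succ N ih =>
    intro x
    rw [Finset.sum_range_succ']
    simp only [fh_succ, fh_zero]
    rw [Finset.sum_comm, ← Finset.sum_add_distrib]
    refine le_trans ?_ hp.le
    refine Finset.sum_le_sum fun z _ => ?_
    rw [← Finset.mul_sum, ← mul_add]
    refine mul_le_of_le_one_right' ?_
    by_cases h : x + (z : Zd d) = y
    · simp [h]
    · simpa [h] using ih (x + z)

lemma n1_nonneg {d : ℕ} (ξ : Fin d → ℝ) : 0 ≤ n1 ξ := by
  unfold n1
  positivity

lemma norm_le_n1 {d : ℕ} (ξ : Fin d → ℝ) : ‖ξ‖ ≤ n1 ξ := by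
  rw [pi_norm_le_iff_of_nonneg (n1_nonneg ξ)]
  intro i
  exact Finset.single_le_sum (f := fun i => |ξ i|) (fun i _ => abs_nonneg _) (Finset.mem_univ i)

lemma toR_sum {d : ℕ} (n : ℕ) (f : ℕ → Zd d) :
    toR (∑ i ∈ Finset.range n, f i) = ∑ i ∈ Finset.range n, toR (f i) := by
  funext j
  simp [toR, Finset.sum_apply]

end RWRP

open RWRP in
/-- uniform lower bound `a(x,y) ≥ -C|y-x|₁`. -/
theorem statement14
    {d : ℕ} {Ω : Type*} [MeasurableSpace Ω]
    (ℙ : Measure Ω) [IsProbabilityMeasure ℙ]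
    (T : Zd d → Ω → Ω) (R : Finset (Zd d)) (V : Ω → Zd d → ℝ) (p : Zd d → ℝ)
    (hset : Setting ℙ T R V p)
    (U₀ : Set (Fin d → ℝ)) (hU₀ : IsZeroFace R U₀)
    (hV0 : ∀ z ∈ R0 R U₀, ∀ᵐ ω ∂ℙ, 0 ≤ V ω z)
    (hVc : ∃ c : ℝ, ∀ z ∈ R, toR z ∉ U₀ → ∀ᵐ ω ∂ℙ, c ≤ V ω z) :
    ∃ C : ℝ, 0 < C ∧ ∀ᵐ ω ∂ℙ, ∀ x y : Zd d, y - x ∈ Gp R →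
      ((-(C * n1Z (y - x)) : ℝ) : EReal) ≤ aE T V p R ω x y := by
  obtain ⟨f, δ, hδ, hf0, hfδ⟩ := aux_sep R U₀ hU₀
  obtain ⟨c, hc⟩ := hVc
  obtain ⟨-, -, -, hT, -, -, hp, hp1⟩ := hset
  have hp1' : ∑ z : {z : Zd d // z ∈ R}, ENNReal.ofReal (p z) = 1 := by
    rw [← ENNReal.ofReal_sum_of_nonneg (fun (z : {z : Zd d // z ∈ R}) _ => (hp z.1 z.2).1.le)]
    rw [Finset.sum_coe_sort R p, hp1, ENNReal.ofReal_one]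
  set K : ℝ := |c| / δ with hKdef
  have hK : 0 ≤ K := by positivity
  refine ⟨K * ‖f‖ + 1, by positivity, ?_⟩
  have key : ∀ᵐ ω ∂ℙ, ∀ z ∈ R, -(K * f (toR z)) ≤ V ω z := by
    rw [ae_all_iff]
    intro z
    by_cases hz : z ∈ R
    · by_cases hz0 : toR z ∈ U₀
      · filter_upwards [hV0 z ⟨hz, hz0⟩] with ω h _
        rw [hf0 z hz hz0]; simpa using h
      · filter_upwards [hc z hz hz0] with ω h _
        have h1 : |c| ≤ K * f (toR z) := by
          calc |c| = K * δ := by rw [hKdef]; field_simp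
            _ ≤ _ := mul_le_mul_of_nonneg_left (hfδ z hz hz0) hK
        have := neg_abs_le c
        linarith
    · exact Eventually.of_forall fun ω h => absurd h hz
  have key2 : ∀ᵐ ω ∂ℙ, ∀ x : Zd d, ∀ z ∈ R, -(K * f (toR z)) ≤ V (T x ω) z := by
    rw [ae_all_iff]
    intro x
    exact (hT x).quasiMeasurePreserving.ae key
  filter_upwards [key2] with ω hω x y _
  have hn1 : 0 ≤ n1Z (y - x) := n1_nonneg _
  unfold aE
  split_ifs with hyx
  · rw [← EReal.coe_zero, EReal.coe_le_coe_iff]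
    have : 0 ≤ (K * ‖f‖ + 1) * n1Z (y - x) := by positivity
    linarith
  set C := K * ‖f‖ + 1
  have hwalk : walkK T V p R ω x y ≤ ENNReal.ofReal (Real.exp (C * n1Z (y - x))) := by
    set E := ENNReal.ofReal (Real.exp (C * n1Z (y - x)))
    calc walkK T V p R ω x y ≤ ∑' n, fh p R y n x * E := by
          unfold walkK fh
          refine ENNReal.tsum_le_tsum fun n => ?_
          rw [Finset.sum_mul]
          refine Finset.sum_le_sum fun s _ => ?_
          split_ifs with hh
          · refine mul_le_mul_right ?_ _
            refine ENNReal.ofReal_le_ofReal (Real.exp_le_exp.2 ?_)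
            have hsum : y - x = ∑ i ∈ Finset.range (n+1), stepF (n+1) s i := by
              rw [← hh.1, pos]; abel
            have h1 : -(K * f (toR (y - x))) ≤ pathV T V ω x (n+1) (stepF (n+1) s) := by
              rw [hsum, toR_sum, map_sum, Finset.mul_sum, ← Finset.sum_neg_distrib]
              refine Finset.sum_le_sum fun i hi => hω _ _ ?_
              rw [Finset.mem_range] at hi
              simp [stepF, hi]
            have h2 : f (toR (y - x)) ≤ ‖f‖ * n1Z (y - x) :=
              (le_abs_self _).trans ((f.le_opNorm _).trans
                (mul_le_mul_of_nonneg_left (norm_le_n1 _) (norm_nonneg _)))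
            have h3 := mul_le_mul_of_nonneg_left h2 hK
            have h4 : C * n1Z (y - x) = K * (‖f‖ * n1Z (y - x)) + n1Z (y - x) := by
              simp only [C]; ring
            linarith
          · simp
      _ = (∑' n, fh p R y n x) * E := ENNReal.tsum_mul_right
      _ ≤ 1 * E := by
          gcongr
          refine ENNReal.tsum_le_of_sum_range_le fun N => fh_sum_le p R y hp1' N x
      _ = E := one_mul _
  have hlog := ENNReal.log_monotone hwalk
  rw [ENNReal.log_ofReal_of_pos (Real.exp_pos _), Real.log_exp] at hlog
  rw [EReal.coe_neg]
  exact EReal.neg_le_neg_iff.2 hlog
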